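/- Let a > 0 and E ∈ ℝ. The coefficients ε_n(E) of the formal eigenvectors of the free-particle Hamiltonian Ĥ_f = p̂²/2 satisfy, for all n ≥ 0 (with the conventions ε_{−2} = ε_{−1} = 0), the three-term recurrences (2n − 2E + a)·ε_{2n}(E) = √(n(n+a−1))·ε_{2n−2}(E) + √((n+1)(n+a))·ε_{2n+2}(E) in the even subspace and (2n − 2E + a + 1)·ε_{2n+1}(E) = √(n(n+a))·ε_{2n−1}(E) + √((n+1)(n+a+1))·ε_{2n+3}(E) in the odd subspace. -/

import Mathlib

/-- Pochhammer symbol `(c)_k` in `ℝ`. -/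
noncomputable def pochR (c : ℝ) (k : ℕ) : ℝ := ∏ j ∈ Finset.range k, (c + j)

/-- The prefactor `ℰ₀(E) = E^{(a−1)/2}·e^{−E}·√(2^a)/√Γ(a)`. -/
noncomputable def calE0 (a E : ℝ) : ℝ :=
  E ^ ((a - 1) / 2) * Real.exp (-E) * Real.sqrt ((2 : ℝ) ^ a) / Real.sqrt (Real.Gamma a)

/-- The prefactor `ℰ₁(E) = E^{a/2}·e^{−E}·√(2^{a+1})/√Γ(a+1)`. -/
noncomputable def calE1 (a E : ℝ) : ℝ :=
  E ^ (a / 2) * Real.exp (-E) * Real.sqrt ((2 : ℝ) ^ (a + 1)) / Real.sqrt (Real.Gamma (a + 1))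

/-- The coefficient `ε_{2n}(E) = √((a)_n/n!)·ℰ₀(E)·₁F₁(−n; a; 2E)`,
a normalized Laguerre function. -/
noncomputable def epsEv (a E : ℝ) (n : ℕ) : ℝ :=
  Real.sqrt (pochR a n / n.factorial) * calE0 a E *
    ∑ k ∈ Finset.range (n + 1),
      pochR (-(n : ℝ)) k / (pochR a k * k.factorial) * (2 * E) ^ k

/-- The coefficient `ε_{2n+1}(E) = √((a+1)_n/n!)·ℰ₁(E)·₁F₁(−n; a+1; 2E)`,
a normalized Laguerre function. -/
noncomputable def epsOdd (a E : ℝ) (n : ℕ) : ℝ :=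
  Real.sqrt (pochR (a + 1) n / n.factorial) * calE1 a E *
    ∑ k ∈ Finset.range (n + 1),
      pochR (-(n : ℝ)) k / (pochR (a + 1) k * k.factorial) * (2 * E) ^ k

theorem pochR_succ (c : ℝ) (k : ℕ) : pochR c (k + 1) = pochR c k * (c + k) := by
  simp [pochR, Finset.prod_range_succ]

theorem pochR_succ' (c : ℝ) (k : ℕ) : pochR c (k + 1) = c * pochR (c + 1) k := by
  simp only [pochR, Finset.prod_range_succ', Nat.cast_add, Nat.cast_zero, add_zero, Nat.cast_one]
  rw [mul_comm]
  congr 1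
  exact Finset.prod_congr rfl fun j _ => by ring

theorem pochR_pos {c : ℝ} (hc : 0 < c) (k : ℕ) : 0 < pochR c k :=
  Finset.prod_pos fun _ _ => by positivity

theorem pochR_neg_natCast_eq_zero {n k : ℕ} (h : n < k) : pochR (-(n : ℝ)) k = 0 :=
  Finset.prod_eq_zero (Finset.mem_range.2 h) (by simp)

/-- The partial sum with `N` terms of the Kummer series `₁F₁(c; b; x)`. -/
noncomputable def kummerSum (b c x : ℝ) (N : ℕ) : ℝ :=
  ∑ k ∈ Finset.range N, pochR c k / (pochR b k * k.factorial) * x ^ k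

theorem kummerSum_neg_natCast (b x : ℝ) {n N : ℕ} (h : n + 1 ≤ N) :
    kummerSum b (-(n : ℝ)) x N = kummerSum b (-(n : ℝ)) x (n + 1) := by
  refine (Finset.sum_subset (Finset.range_subset_range.2 h) fun k _ hk => ?_).symm
  rw [pochR_neg_natCast_eq_zero (by simpa using hk)]
  simp

/-- The contiguous relation of the Kummer series in its first parameter, for partial sums. -/
theorem kummerSum_contiguous {b : ℝ} (hb : 0 < b) (ν x : ℝ) (N : ℕ) :
    (2 * ν + b) * kummerSum b (-ν) x (N + 1) - x * kummerSum b (-ν) x N =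
      ν * kummerSum b (-ν + 1) x (N + 1) + (ν + b) * kummerSum b (-ν - 1) x (N + 1) := by
  have coeff (k : ℕ) :
      (2 * ν + b) * (pochR (-ν) (k + 1) / (pochR b (k + 1) * (k + 1).factorial)) -
          pochR (-ν) k / (pochR b k * k.factorial) =
        ν * (pochR (-ν + 1) (k + 1) / (pochR b (k + 1) * (k + 1).factorial)) +
          (ν + b) * (pochR (-ν - 1) (k + 1) / (pochR b (k + 1) * (k + 1).factorial)) := by
    have h1 : ν * pochR (-ν + 1) (k + 1) = -(pochR (-ν) k * (-ν + k) * (-ν + (k + 1))) := by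
      have h := pochR_succ' (-ν) (k + 1)
      rw [pochR_succ, pochR_succ] at h
      push_cast at h
      linarith
    have h2 : pochR (-ν - 1) (k + 1) = (-ν - 1) * pochR (-ν) k := by
      rw [pochR_succ', sub_add_cancel]
    have hp := (pochR_pos hb k).ne'
    have hbk : b + k ≠ 0 := by positivity
    have hf : (k.factorial : ℝ) ≠ 0 := by positivity
    have hk : (k : ℝ) + 1 ≠ 0 := by positivity
    rw [← mul_div_assoc ν, h1, h2, pochR_succ (-ν), pochR_succ b, Nat.factorial_succ]
    push_cast
    field_simp
    ring
  induction N with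
  | zero =>
    simp [kummerSum, pochR]
    ring
  | succ N ih =>
    have step (c : ℝ) (M : ℕ) : kummerSum b c x (M + 1) =
        kummerSum b c x M + pochR c M / (pochR b M * M.factorial) * x ^ M :=
      Finset.sum_range_succ _ _
    rw [step _ (N + 1), step (-ν + 1) (N + 1), step (-ν - 1) (N + 1)]
    have hx := step (-ν) N
    linear_combination ih + x ^ (N + 1) * coeff N - x * hx

theorem sqrt_pochR_div_factorial_succ {b : ℝ} (hb : 0 < b) (n : ℕ) :
    √(pochR b (n + 1) / (n + 1).factorial) =
      √(pochR b n / n.factorial) * (√(n + b) / √(n + 1)) := by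
  have hp := pochR_pos hb n
  rw [← Real.sqrt_div (by positivity), ← Real.sqrt_mul (by positivity), pochR_succ,
    Nat.factorial_succ]
  congr 1
  push_cast
  field_simp
  ring

/-- The three-term recurrence of the normalized Laguerre functions with parameter `b`. -/
theorem laguerre_recurrence {b : ℝ} (hb : 0 < b) (C x : ℝ) (f : ℕ → ℝ)
    (hf : ∀ n : ℕ, f n =
      √(pochR b n / n.factorial) * C * kummerSum b (-(n : ℝ)) x (n + 1)) (n : ℕ) :
    (2 * (n : ℝ) - x + b) * f n =
      √((n : ℝ) * (n + b - 1)) * (if n = 0 then 0 else f (n - 1)) +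
        √(((n : ℝ) + 1) * (n + b)) * f (n + 1) := by
  have up (m : ℕ) : √(((m : ℝ) + 1) * (m + b)) * √(pochR b (m + 1) / (m + 1).factorial) =
      (m + b) * √(pochR b m / m.factorial) := by
    have h := Real.mul_self_sqrt (show (0 : ℝ) ≤ m + b by positivity)
    have h1 : √((m : ℝ) + 1) ≠ 0 := by positivity
    rw [sqrt_pochR_div_factorial_succ hb, Real.sqrt_mul (by positivity)]
    field_simp
    linear_combination √(pochR b m / m.factorial) * h
  have down (m : ℕ) : √(((m : ℝ) + 1) * (m + b)) * √(pochR b m / m.factorial) =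
      (m + 1) * √(pochR b (m + 1) / (m + 1).factorial) := by
    have h := Real.mul_self_sqrt (show (0 : ℝ) ≤ m + 1 by positivity)
    have h1 : √((m : ℝ) + 1) ≠ 0 := by positivity
    rw [sqrt_pochR_div_factorial_succ hb, Real.sqrt_mul (by positivity)]
    field_simp
    linear_combination √(pochR b m / m.factorial) * h
  have key := kummerSum_contiguous hb n x (n + 1)
  rw [kummerSum_neg_natCast b x (Nat.le_succ (n + 1)),
    show -(n : ℝ) - 1 = -((n + 1 : ℕ) : ℝ) by push_cast; ring] at key
  cases n with
  | zero =>
    have hu := up 0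
    simp only [hf, if_true, mul_zero]
    norm_num at key hu ⊢
    linear_combination √(pochR b 0) * C * key -
      C * kummerSum b (-1) x 2 * hu
  | succ m =>
    have hu := up (m + 1)
    have hd := down m
    rw [show -((m + 1 : ℕ) : ℝ) + 1 = -(m : ℝ) by push_cast; ring,
      kummerSum_neg_natCast b x (show m + 1 ≤ m + 1 + 1 + 1 by lia)] at key
    rw [if_neg m.succ_ne_zero, Nat.add_sub_cancel, hf, hf, hf,
      show ((m + 1 : ℕ) : ℝ) * ((m + 1 : ℕ) + b - 1) = (m + 1) * (m + b) by push_cast; ring]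
    push_cast at key hu ⊢
    linear_combination √(pochR b (m + 1) / ((m + 1).factorial : ℝ)) * C * key -
      C * kummerSum b (-(m + 1 + 1)) x (m + 1 + 1 + 1) * hu -
      C * kummerSum b (-m) x (m + 1) * hd

/-- the coefficients `ε_n(E)` of the formal eigenvectors of the
free-particle Hamiltonian `Ĥ_f = p̂²/2` satisfy, with the conventions
`ε_{−2} = ε_{−1} = 0`, the three-term recurrences
`(2n − 2E + a)·ε_{2n} = √(n(n+a−1))·ε_{2n−2} + √((n+1)(n+a))·ε_{2n+2}` and
`(2n − 2E + a + 1)·ε_{2n+1} = √(n(n+a))·ε_{2n−1} + √((n+1)(n+a+1))·ε_{2n+3}`. -/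
theorem eps_recurrence (a E : ℝ) (ha : 0 < a) (n : ℕ) :
    ((2 * (n : ℝ) - 2 * E + a) * epsEv a E n =
        Real.sqrt ((n : ℝ) * ((n : ℝ) + a - 1)) * (if n = 0 then 0 else epsEv a E (n - 1))
          + Real.sqrt (((n : ℝ) + 1) * ((n : ℝ) + a)) * epsEv a E (n + 1)) ∧
    ((2 * (n : ℝ) - 2 * E + a + 1) * epsOdd a E n =
        Real.sqrt ((n : ℝ) * ((n : ℝ) + a)) * (if n = 0 then 0 else epsOdd a E (n - 1))
          + Real.sqrt (((n : ℝ) + 1) * ((n : ℝ) + a + 1)) * epsOdd a E (n + 1)) := by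
  constructor
  · exact laguerre_recurrence ha (calE0 a E) (2 * E) (epsEv a E) (fun _ => rfl) n
  · have h := laguerre_recurrence (b := a + 1) (by positivity) (calE1 a E) (2 * E) (epsOdd a E)
      (fun _ => rfl) n
    rwa [← add_assoc, ← add_assoc, add_sub_cancel_right] at h
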